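/- arXiv:2211.14853 — 3 statements merged into one kernel-verified Lean document; each statement's English description precedes it below -/
import Mathlib

section
/- For every natural number N ≥ 1, the Legendre polynomial L_N defined by Rodrigues' formula has exactly N distinct real roots, all lying in the open interval (−1, 1). -/
/-- The Legendre polynomial of degree `k`, defined by Rodrigues' formula
`L_k(x) = (1/(2^k k!)) dᵏ/dxᵏ [(x² − 1)ᵏ]`. -/
noncomputable def legendre (k : ℕ) : Polynomial ℝ :=
  ((1 : ℝ) / (2 ^ k * k.factorial)) •
    ((fun p : Polynomial ℝ => Polynomial.derivative p)^[k] ((Polynomial.X ^ 2 - 1) ^ k))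

open Polynomial in
/-- Iterated use of Rolle's theorem: if a polynomial has `n + 1` distinct roots in `[a, b]`, its
derivative has `n` distinct roots in `(a, b)`. -/
theorem exists_finset_roots_derivative {p : ℝ[X]} {a b : ℝ} {n : ℕ} {T : Finset ℝ}
    (hcard : T.card = n + 1) (hT : ∀ x ∈ T, x ∈ Set.Icc a b) (hp : ∀ x ∈ T, p.eval x = 0) :
    ∃ S : Finset ℝ, S.card = n ∧ (∀ x ∈ S, x ∈ Set.Ioo a b) ∧
      ∀ x ∈ S, (derivative p).eval x = 0 := by
  set e := T.orderEmbOfFin hcard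
  have he (i) : e i ∈ T := T.orderEmbOfFin_mem hcard i
  have rolle (i : Fin n) :
      ∃ c ∈ Set.Ioo (e i.castSucc) (e i.succ), (derivative p).eval c = 0 := by
    obtain ⟨c, hc, hc'⟩ := exists_deriv_eq_zero (f := fun x => p.eval x)
      (e.strictMono i.castSucc_lt_succ) p.continuous.continuousOn
      ((hp _ (he _)).trans (hp _ (he _)).symm)
    exact ⟨c, hc, by rwa [Polynomial.deriv] at hc'⟩
  choose c hc hc' using rolle
  have hmono : StrictMono c := fun i j hij =>
    (hc i).2.trans ((e.monotone (Fin.succ_le_castSucc_iff.2 hij)).trans_lt (hc j).1)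
  refine ⟨Finset.univ.map ⟨c, hmono.injective⟩, by simp, ?_, ?_⟩
  · simp only [Finset.mem_map, Finset.mem_univ, true_and, Function.Embedding.coeFn_mk,
      forall_exists_index, forall_apply_eq_imp_iff]
    exact fun i => ⟨(hT _ (he _)).1.trans_lt (hc i).1, (hc i).2.trans_le (hT _ (he _)).2⟩
  · simpa using hc'

open Polynomial in
theorem eval_iterate_derivative_X_sq_sub_one_pow {N k : ℕ} (hk : k < N) {x : ℝ}
    (hx : x ^ 2 = 1) : (derivative^[k] ((X ^ 2 - 1 : ℝ[X]) ^ N)).eval x = 0 := by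
  obtain ⟨q, hq⟩ := pow_sub_dvd_iterate_derivative_of_pow_dvd k
    (dvd_refl ((X ^ 2 - 1 : ℝ[X]) ^ N))
  rw [hq]
  simp [hx, Nat.sub_ne_zero_of_lt hk]

open Polynomial in
theorem exists_finset_roots_iterate_derivative_X_sq_sub_one_pow {N k : ℕ} (hk : k ≤ N) :
    ∃ S : Finset ℝ, S.card = k ∧ (∀ x ∈ S, x ∈ Set.Ioo (-1 : ℝ) 1) ∧
      ∀ x ∈ S, (derivative^[k] ((X ^ 2 - 1 : ℝ[X]) ^ N)).eval x = 0 := by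
  induction k with
  | zero => exact ⟨∅, by simp⟩
  | succ k ih =>
    obtain ⟨S, hcard, hS, hroot⟩ := ih (by lia)
    have h1 : (1 : ℝ) ∉ S := fun h => lt_irrefl _ (hS 1 h).2
    have h2 : (-1 : ℝ) ∉ insert 1 S := by
      rw [Finset.mem_insert, not_or]
      exact ⟨by norm_num, fun h => lt_irrefl _ (hS _ h).1⟩
    rw [Function.iterate_succ_apply']
    refine exists_finset_roots_derivative (T := insert (-1) (insert 1 S)) ?_ ?_ ?_
    · rw [Finset.card_insert_of_notMem h2, Finset.card_insert_of_notMem h1, hcard]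
    · simp only [Finset.forall_mem_insert]
      exact ⟨by norm_num, by norm_num, fun x hx => Set.Ioo_subset_Icc_self (hS x hx)⟩
    · simp only [Finset.forall_mem_insert]
      exact ⟨eval_iterate_derivative_X_sq_sub_one_pow hk (by norm_num),
        eval_iterate_derivative_X_sq_sub_one_pow hk (by norm_num), hroot⟩

open Polynomial in
theorem natDegree_X_sq_sub_one_pow (N : ℕ) : ((X ^ 2 - 1 : ℝ[X]) ^ N).natDegree = N + N := by
  rw [natDegree_pow, ← C_1, natDegree_X_pow_sub_C]
  ring

open Polynomial in
theorem iterate_derivative_X_sq_sub_one_pow_ne_zero (N : ℕ) :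
    derivative^[N] ((X ^ 2 - 1 : ℝ[X]) ^ N) ≠ 0 := by
  intro h
  have hmonic : ((X ^ 2 - 1 : ℝ[X]) ^ N).Monic := by
    rw [← C_1]
    exact (monic_X_pow_sub_C 1 two_ne_zero).pow N
  have hcoeff := congrArg (coeff · N) h
  rw [coeff_iterate_derivative, ← natDegree_X_sq_sub_one_pow, hmonic.coeff_natDegree,
    natDegree_X_sq_sub_one_pow] at hcoeff
  simp [Nat.descFactorial_eq_zero_iff_lt] at hcoeff

/-- For `N ≥ 1`, `L_N` has exactly `N` distinct real roots,
all lying in the open interval `(−1, 1)`. -/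
theorem legendre_roots (N : ℕ) (hN : 1 ≤ N) :
    ∃ S : Finset ℝ, S.card = N ∧ (↑S ⊆ Set.Ioo (-1 : ℝ) 1) ∧
      ∀ x : ℝ, (legendre N).eval x = 0 ↔ x ∈ S := by
  obtain ⟨S, hcard, hS, hroot⟩ :=
    exists_finset_roots_iterate_derivative_X_sq_sub_one_pow (le_refl N)
  have hne := iterate_derivative_X_sq_sub_one_pow_ne_zero N
  have hdeg := Polynomial.natDegree_iterate_derivative ((Polynomial.X ^ 2 - 1 : Polynomial ℝ) ^ N) N
  rw [natDegree_X_sq_sub_one_pow, Nat.add_sub_cancel] at hdeg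
  have hlegendre (x : ℝ) : (legendre N).eval x = 0 ↔
      (Polynomial.derivative^[N] ((Polynomial.X ^ 2 - 1 : Polynomial ℝ) ^ N)).eval x = 0 := by
    rw [legendre, Polynomial.eval_smul, smul_eq_zero_iff_right (by positivity)]
  refine ⟨S, hcard, hS, fun x => (hlegendre x).trans ⟨fun hx => ?_, hroot x⟩⟩
  have hsub : S ⊆ (Polynomial.derivative^[N]
      ((Polynomial.X ^ 2 - 1 : Polynomial ℝ) ^ N)).roots.toFinset := fun y hy => by
    rw [Multiset.mem_toFinset, Polynomial.mem_roots hne]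
    exact hroot y hy
  rw [Finset.eq_of_subset_of_card_le hsub
    ((Multiset.toFinset_card_le _).trans ((Polynomial.card_roots' _).trans (hdeg.trans hcard.ge))),
    Multiset.mem_toFinset, Polynomial.mem_roots hne]
  exact hx
end

section
/- (Legendre–Gauss–Lobatto quadrature exactness) Let N ≥ 2 and let the N Legendre–Gauss–Lobatto nodes be τ_1 = −1, τ_N = 1, and τ_2 < ⋯ < τ_{N−1} the N − 2 distinct roots in (−1,1) of the derivative L′_{N−1} of the Legendre polynomial of degree N − 1. Then there exist real weights w_1, …, w_N such that for every real polynomial p of degree at most 2N − 3, ∫_{−1}^{1} p(x) dx = Σ_{i=1}^{N} w_i p(τ_i). -/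
open Polynomial

/-- Integration by parts for real polynomials whose first factor vanishes at both endpoints. -/
lemma Polynomial.integral_derivative_mul_eq_neg {a b : ℝ} (f g : ℝ[X])
    (ha : f.eval a = 0) (hb : f.eval b = 0) :
    ∫ x in a..b, (derivative f * g).eval x = -∫ x in a..b, (f * derivative g).eval x := by
  have h : ∫ x in a..b, (derivative (f * g)).eval x = (f * g).eval b - (f * g).eval a :=
    intervalIntegral.integral_eq_sub_of_hasDerivAt (fun x _ => (f * g).hasDerivAt x)
      ((derivative (f * g)).continuous.intervalIntegrable a b)
  rw [derivative_mul] at h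
  simp only [eval_add] at h
  rw [intervalIntegral.integral_add ((derivative f * g).continuous.intervalIntegrable a b)
    ((f * derivative g).continuous.intervalIntegrable a b)] at h
  simp only [eval_mul, ha, hb, zero_mul, sub_zero] at h ⊢
  linarith

/-- The `k`-th derivative of `(x² - 1)ⁿ`, `k ≤ n`, is orthogonal on `[-1, 1]` to every polynomial
of degree less than `k`. -/
lemma integral_iterate_derivative_sq_sub_one_pow_mul (n : ℕ) {k : ℕ} (hk : k ≤ n) (s : ℝ[X])
    (hs : s.degree < k) :
    ∫ x in (-1 : ℝ)..1, (derivative^[k] ((X ^ 2 - 1 : ℝ[X]) ^ n) * s).eval x = 0 := by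
  induction k generalizing s with
  | zero =>
    obtain rfl : s = 0 := by
      rw [← degree_eq_bot]
      exact Nat.WithBot.lt_zero_iff.1 (by simpa using hs)
    simp
  | succ k ih =>
    have hdvd : (X ^ 2 - 1 : ℝ[X]) ∣ derivative^[k] ((X ^ 2 - 1 : ℝ[X]) ^ n) :=
      (dvd_pow_self _ (by omega)).trans (pow_sub_dvd_iterate_derivative_pow _ n k)
    rw [Function.iterate_succ_apply', integral_derivative_mul_eq_neg, ih (by omega), neg_zero]
    · rcases eq_or_ne s 0 with rfl | h
      · simp
      · exact (degree_derivative_lt h).trans_le (Order.le_of_lt_succ hs)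
    · exact eval_eq_zero_of_dvd_of_eval_eq_zero hdvd (by simp)
    · exact eval_eq_zero_of_dvd_of_eval_eq_zero hdvd (by simp)

lemma integral_legendre_mul_eq_zero (n : ℕ) (s : ℝ[X]) (hs : s.degree < n) :
    ∫ x in (-1 : ℝ)..1, (legendre n * s).eval x = 0 := by
  simp only [legendre, smul_mul_assoc, eval_smul, smul_eq_mul,
    intervalIntegral.integral_const_mul]
  exact mul_eq_zero_of_right _ (integral_iterate_derivative_sq_sub_one_pow_mul n le_rfl s hs)

lemma natDegree_legendre_le (n : ℕ) : (legendre n).natDegree ≤ n := by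
  refine (natDegree_smul_le _ _).trans ((natDegree_iterate_derivative _ n).trans ?_)
  have : ((X ^ 2 - 1 : ℝ[X]) ^ n).natDegree = n * 2 := by
    rw [natDegree_pow]
    congr 1
    compute_degree!
  omega

lemma derivative_legendre_ne_zero {n : ℕ} (hn : 1 ≤ n) : derivative (legendre n) ≠ 0 := by
  obtain ⟨m, rfl⟩ := Nat.exists_eq_add_of_le' hn
  have hmonic : ((X ^ 2 - 1 : ℝ[X]) ^ (m + 1)).Monic :=
    (monic_X_pow_sub_C (1 : ℝ) two_ne_zero).pow _
  have hdeg : ((X ^ 2 - 1 : ℝ[X]) ^ (m + 1)).natDegree = m + (m + 1 + 1) := by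
    rw [natDegree_pow, show (X ^ 2 - 1 : ℝ[X]).natDegree = 2 by compute_degree!]
    ring
  rw [legendre, derivative_smul, ← Function.iterate_succ_apply' (fun p : ℝ[X] => derivative p)]
  refine smul_ne_zero (by positivity) fun h => ?_
  have hc : (derivative^[m + 1 + 1] ((X ^ 2 - 1 : ℝ[X]) ^ (m + 1))).coeff m = 0 :=
    congrArg (coeff · m) h
  rw [coeff_iterate_derivative, ← hdeg, hmonic.coeff_natDegree, hdeg, nsmul_eq_mul, mul_one,
    Nat.cast_eq_zero, Nat.descFactorial_eq_zero_iff_lt] at hc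
  omega

/-- The product of `x² - 1` and the derivative of `legendre n` is orthogonal on `[-1, 1]` to every polynomial of degree less than `n - 1`. -/
lemma integral_sq_sub_one_mul_derivative_legendre_mul {n : ℕ} (r : ℝ[X])
    (hr : r.degree < (n - 1 : ℕ)) :
    ∫ x in (-1 : ℝ)..1, ((X ^ 2 - 1) * derivative (legendre n) * r).eval x = 0 := by
  rcases eq_or_ne r 0 with rfl | h
  · simp
  have hr' : r.natDegree < n - 1 := (natDegree_lt_iff_degree_lt h).2 hr
  have hdeg : (derivative ((X ^ 2 - 1) * r)).natDegree < n := by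
    have h₁ := natDegree_derivative_le ((X ^ 2 - 1) * r)
    have h₂ := natDegree_mul_le (p := (X ^ 2 - 1 : ℝ[X])) (q := r)
    have h₃ : (X ^ 2 - 1 : ℝ[X]).natDegree = 2 := by compute_degree!
    omega
  have hparts := integral_derivative_mul_eq_neg (a := -1) (b := 1) ((X ^ 2 - 1) * r) (legendre n)
    (by simp) (by simp)
  rw [mul_comm (derivative _), integral_legendre_mul_eq_zero n _
    (degree_le_natDegree.trans_lt (by exact_mod_cast hdeg)), zero_eq_neg] at hparts
  rw [← hparts]
  congr 1 with x
  simp only [eval_mul]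
  ring

/-- If the nodal polynomial of `v` is orthogonal to all polynomials of degree less than `d`, then
the interpolatory quadrature rule with nodes `v` is exact in degree less than `card ι + d`. -/
lemma exists_quadrature_weights {ι : Type*} [Fintype ι] {v : ι → ℝ} (hv : Function.Injective v)
    {a b : ℝ} {d : ℕ}
    (horth : ∀ r : ℝ[X], r.degree < d →
      ∫ x in a..b, (Lagrange.nodal Finset.univ v * r).eval x = 0) :
    ∃ w : ι → ℝ, ∀ p : ℝ[X], p.degree < (Fintype.card ι + d : ℕ) →
      ∫ x in a..b, p.eval x = ∑ i, w i * p.eval (v i) := by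
  classical
  refine ⟨fun i => ∫ x in a..b, (Lagrange.basis Finset.univ v i).eval x, fun p hp => ?_⟩
  set ω := Lagrange.nodal Finset.univ v with hω
  have hmonic : ω.Monic := Lagrange.nodal_monic
  have hmod : p %ₘ ω = Lagrange.interpolate Finset.univ v fun i => p.eval (v i) := by
    refine Lagrange.eq_interpolate_of_eval_eq _ hv.injOn ?_ fun i hi => ?_
    · exact (degree_modByMonic_lt p hmonic).trans_eq Lagrange.degree_nodal
    · conv_rhs => rw [← modByMonic_add_div p ω]
      simp [hω, Lagrange.eval_nodal_at_node hi]
  have hdiv : (p /ₘ ω).degree < d := by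
    rcases eq_or_ne (p /ₘ ω) 0 with h | h
    · simp [h, bot_lt_iff_ne_bot]
    rw [← natDegree_lt_iff_degree_lt h, natDegree_divByMonic p hmonic, hω,
      Lagrange.natDegree_nodal, Finset.card_univ]
    have hp' : p ≠ 0 := by rintro rfl; simp at h
    have h₁ := (natDegree_lt_iff_degree_lt hp').2 hp
    have h₂ : Fintype.card ι ≤ p.natDegree := by
      rw [← Finset.card_univ, ← Lagrange.natDegree_nodal (s := Finset.univ) (v := v)]
      by_contra! hlt
      exact h ((divByMonic_eq_zero_iff hmonic).2 (degree_lt_degree hlt))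
    omega
  conv_lhs => rw [← modByMonic_add_div p ω]
  simp only [eval_add]
  rw [intervalIntegral.integral_add ((p %ₘ ω).continuous.intervalIntegrable a b)
    ((ω * (p /ₘ ω)).continuous.intervalIntegrable a b), horth _ hdiv, add_zero, hmod]
  simp only [Lagrange.interpolate_apply, eval_finsetSum, eval_mul, eval_C]
  rw [intervalIntegral.integral_finsetSum fun i _ =>
    (((Lagrange.basis Finset.univ v i).continuous.const_mul _).intervalIntegrable a b)]
  exact Finset.sum_congr rfl fun i _ => by
    rw [intervalIntegral.integral_const_mul, mul_comm]

/-- Legendre–Gauss–Lobatto quadrature exactness: with nodes `τ_1 = −1`,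
`τ_N = 1`, and `τ_2 < ⋯ < τ_{N−1}` the `N − 2` distinct roots of `L′_{N−1}` in `(−1,1)`,
there exist weights `w_1, …, w_N` such that `∫_{−1}^{1} p = ∑ w_i p(τ_i)` for every
polynomial `p` of degree at most `2N − 3`. -/
theorem lobatto_quadrature (N : ℕ) (hN : 2 ≤ N) (τ : Fin N → ℝ)
    (hmono : StrictMono τ)
    (h0 : τ ⟨0, by omega⟩ = -1) (hlast : τ ⟨N - 1, by omega⟩ = 1)
    (hroot : ∀ i : Fin N, 0 < (i : ℕ) → (i : ℕ) < N - 1 →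
      τ i ∈ Set.Ioo (-1 : ℝ) 1 ∧
        (Polynomial.derivative (legendre (N - 1))).eval (τ i) = 0)
    (hall : ∀ x ∈ Set.Ioo (-1 : ℝ) 1,
      (Polynomial.derivative (legendre (N - 1))).eval x = 0 → ∃ i, τ i = x) :
    ∃ w : Fin N → ℝ, ∀ p : Polynomial ℝ, p.degree ≤ ((2 * N - 3 : ℕ) : WithBot ℕ) →
      ∫ x in (-1 : ℝ)..1, p.eval x = ∑ i, w i * p.eval (τ i) := by
  set q : ℝ[X] := (X ^ 2 - 1) * derivative (legendre (N - 1)) with hq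
  have hsq : (X ^ 2 - 1 : ℝ[X]).natDegree = 2 := by compute_degree!
  have hq₀ : q ≠ 0 :=
    mul_ne_zero (ne_zero_of_natDegree_gt (n := 0) (by omega))
      (derivative_legendre_ne_zero (by omega))
  have hτ : ∀ i, q.eval (τ i) = 0 := by
    intro i
    rcases Nat.eq_zero_or_pos i with hi | hi
    · rw [show i = ⟨0, by omega⟩ from Fin.ext hi, h0]
      simp [hq]
    rcases (Nat.le_sub_one_of_lt i.2).lt_or_eq with hi' | hi'
    · simp [hq, (hroot i hi hi').2]
    · rw [show i = ⟨N - 1, by omega⟩ from Fin.ext hi', hlast]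
      simp [hq]
  have hdvd : Lagrange.nodal Finset.univ τ ∣ q :=
    Finset.prod_dvd_of_coprime ((pairwise_coprime_X_sub_C hmono.injective).set_pairwise _)
      fun i _ => dvd_iff_isRoot.2 (hτ i)
  have hdeg : q.natDegree ≤ (Lagrange.nodal Finset.univ τ).natDegree := by
    have h₁ := natDegree_mul_le (p := (X ^ 2 - 1 : ℝ[X])) (q := derivative (legendre (N - 1)))
    rw [← hq] at h₁
    have h₂ := natDegree_derivative_le (legendre (N - 1))
    have h₃ := natDegree_legendre_le (N - 1)
    rw [Lagrange.natDegree_nodal, Finset.card_univ, Fintype.card_fin]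
    omega
  have hqω := eq_leadingCoeff_mul_of_monic_of_dvd_of_natDegree_le
    Lagrange.nodal_monic hdvd hdeg
  have horth : ∀ r : ℝ[X], r.degree < (N - 2 : ℕ) →
      ∫ x in (-1 : ℝ)..1, (Lagrange.nodal Finset.univ τ * r).eval x = 0 := by
    intro r hr
    have h := integral_sq_sub_one_mul_derivative_legendre_mul (n := N - 1) r hr
    rw [← hq, hqω, mul_assoc] at h
    simp only [eval_C_mul, intervalIntegral.integral_const_mul] at h
    exact (mul_eq_zero.1 h).resolve_left (leadingCoeff_ne_zero.2 hq₀)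
  obtain ⟨w, hw⟩ := exists_quadrature_weights hmono.injective horth
  refine ⟨w, fun p hp => hw p (hp.trans_lt ?_)⟩
  rw [Fintype.card_fin]
  exact_mod_cast (by omega : 2 * N - 3 < N + (N - 2))
end

section
/- (Legendre–Gauss–Lobatto quadrature weights) Let N ≥ 2 and let τ_1 = −1, τ_N = 1, and τ_2 < ⋯ < τ_{N−1} be the roots in (−1,1) of L′_{N−1}. Define the weights w_i = 2 / (N(N−1) · L_{N−1}(τ_i)²) for i = 1, …, N. Then w_1 = w_N = 2/(N(N−1)), and for every real polynomial p of degree at most 2N − 3, ∫_{−1}^{1} p(x) dx = Σ_{i=1}^{N} w_i p(τ_i). -/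
open Polynomial in
/-- The integral of a real polynomial over `[-1, 1]`, as a linear functional. -/
noncomputable def polyIntegral : ℝ[X] →ₗ[ℝ] ℝ where
  toFun p := ∫ x in (-1 : ℝ)..1, p.eval x
  map_add' p q := by
    simp only [eval_add]
    exact intervalIntegral.integral_add (p.continuous.intervalIntegrable _ _)
      (q.continuous.intervalIntegrable _ _)
  map_smul' c p := by simp

namespace LegendreLobatto

open Polynomial

theorem polyIntegral_derivative (p : ℝ[X]) :
    polyIntegral (derivative p) = p.eval 1 - p.eval (-1) :=
  intervalIntegral.integral_eq_sub_of_hasDerivAt (fun x _ => p.hasDerivAt x)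
    ((derivative p).continuous.intervalIntegrable _ _)

theorem polyIntegral_C_mul (c : ℝ) (p : ℝ[X]) :
    polyIntegral (C c * p) = c * polyIntegral p := by
  rw [← smul_eq_C_mul, map_smul, smul_eq_mul]

theorem legendre_eq_C_mul (n : ℕ) :
    legendre n = C (1 / (2 ^ n * (n.factorial : ℝ))) * derivative^[n] ((X ^ 2 - 1) ^ n) :=
  smul_eq_C_mul _

theorem natDegree_legendre_le (n : ℕ) : (legendre n).natDegree ≤ n := by
  have hdeg : ((X ^ 2 - 1 : ℝ[X]) ^ n).natDegree ≤ n * 2 :=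
    natDegree_pow_le_of_le n (by compute_degree)
  have := natDegree_iterate_derivative ((X ^ 2 - 1 : ℝ[X]) ^ n) n
  rw [legendre_eq_C_mul]
  exact (natDegree_C_mul_le _ _).trans (by omega)

theorem eval_iterate_derivative_X_sub_C_pow_mul (a : ℝ) (n : ℕ) (f : ℝ[X]) :
    (derivative^[n] ((X - C a) ^ n * f)).eval a = n.factorial * f.eval a := by
  induction n generalizing f with
  | zero => simp
  | succ n ih =>
    have h : derivative ((X - C a) ^ (n + 1) * f)
        = (X - C a) ^ n * (C ((n : ℝ) + 1) * f + (X - C a) * derivative f) := by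
      simp only [derivative_mul, derivative_X_sub_C_pow, add_tsub_cancel_right, Nat.cast_add,
        Nat.cast_one, map_add, map_natCast, map_one]
      ring
    rw [Function.iterate_succ_apply, h, ih]
    simp [Nat.factorial_succ]
    ring

theorem eval_one_legendre (n : ℕ) : (legendre n).eval 1 = 1 := by
  have h : (X ^ 2 - 1 : ℝ[X]) ^ n = (X - C 1) ^ n * (X + 1) ^ n := by
    rw [← mul_pow, C_1]; ring
  have hf : (n.factorial : ℝ) ≠ 0 := by positivity
  rw [legendre_eq_C_mul, eval_C_mul, h, eval_iterate_derivative_X_sub_C_pow_mul]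
  simp only [eval_pow, eval_add, eval_X, eval_one]
  norm_num
  field_simp

theorem eval_neg_one_legendre (n : ℕ) : (legendre n).eval (-1) = (-1) ^ n := by
  have h : (X ^ 2 - 1 : ℝ[X]) ^ n = (X - C (-1)) ^ n * (X - 1) ^ n := by
    rw [← mul_pow, C_neg, C_1]; ring
  have hf : (n.factorial : ℝ) ≠ 0 := by positivity
  rw [legendre_eq_C_mul, eval_C_mul, h, eval_iterate_derivative_X_sub_C_pow_mul]
  simp only [eval_pow, eval_sub, eval_X, eval_one]
  rw [show (-1 - 1 : ℝ) = (-1) * 2 by norm_num, mul_pow]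
  field_simp

theorem eval_iterate_derivative_eq_zero {n k : ℕ} (hk : k < n) {a : ℝ} (ha : a ^ 2 = 1) :
    (derivative^[k] ((X ^ 2 - 1 : ℝ[X]) ^ n)).eval a = 0 := by
  have hdvd : X - C a ∣ (X ^ 2 - 1 : ℝ[X]) := dvd_iff_isRoot.2 (by simp [ha])
  have h := pow_sub_dvd_iterate_derivative_of_pow_dvd k (pow_dvd_pow_of_dvd hdvd n)
  exact dvd_iff_isRoot.1 ((dvd_pow_self _ (by omega)).trans h)

theorem polyIntegral_iterate_derivative_mul {n k : ℕ} (hk : k ≤ n) {q : ℝ[X]}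
    (hq : q.degree < (k : WithBot ℕ)) :
    polyIntegral (derivative^[k] ((X ^ 2 - 1 : ℝ[X]) ^ n) * q) = 0 := by
  induction k generalizing q with
  | zero =>
    have : q = 0 := by simpa using hq
    simp [this]
  | succ k ih =>
    have hq' : (derivative q).degree < (k : WithBot ℕ) := by
      rw [degree_lt_iff_coeff_zero] at hq ⊢
      intro m hm
      rw [coeff_derivative, hq _ (by omega), zero_mul]
    have h := polyIntegral_derivative (derivative^[k] ((X ^ 2 - 1 : ℝ[X]) ^ n) * q)
    rw [derivative_mul, map_add, ih (by omega) hq', eval_mul, eval_mul,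
      eval_iterate_derivative_eq_zero (by omega) (by norm_num),
      eval_iterate_derivative_eq_zero (by omega) (by norm_num)] at h
    rw [Function.iterate_succ_apply']
    linarith

/-- `legendre n` is orthogonal to all polynomials of degree less than `n`. -/
theorem polyIntegral_legendre_mul {n : ℕ} {q : ℝ[X]} (hq : q.degree < (n : WithBot ℕ)) :
    polyIntegral (legendre n * q) = 0 := by
  rw [legendre_eq_C_mul, mul_assoc, polyIntegral_C_mul,
    polyIntegral_iterate_derivative_mul le_rfl hq, mul_zero]

theorem iterate_derivative_recurrence (n k : ℕ) :
    (X ^ 2 - 1 : ℝ[X]) * derivative^[k + 2] ((X ^ 2 - 1 : ℝ[X]) ^ n)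
      = 2 * ((n : ℝ[X]) - (k : ℝ[X]) - 1) * X * derivative^[k + 1] ((X ^ 2 - 1 : ℝ[X]) ^ n)
        + ((k : ℝ[X]) + 1) * (2 * (n : ℝ[X]) - (k : ℝ[X]))
          * derivative^[k] ((X ^ 2 - 1 : ℝ[X]) ^ n) := by
  induction k with
  | zero =>
    have h : (X ^ 2 - 1 : ℝ[X]) * derivative ((X ^ 2 - 1 : ℝ[X]) ^ n)
        = 2 * (n : ℝ[X]) * X * (X ^ 2 - 1) ^ n := by
      cases n with
      | zero => simp
      | succ n => simp [derivative_pow, show (C 2 : ℝ[X]) = 2 from map_ofNat C 2]; ring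
    have h' := congrArg derivative h
    simp [derivative_mul] at h' ⊢
    linear_combination h'
  | succ k ih =>
    have h' := congrArg derivative ih
    simp only [Function.iterate_succ_apply'] at h' ⊢
    simp [derivative_mul] at h' ⊢
    linear_combination h'

/-- Legendre's differential equation. -/
theorem derivative_one_sub_X_sq_mul_derivative_legendre (n : ℕ) :
    derivative ((1 - X ^ 2 : ℝ[X]) * derivative (legendre n))
      = -((n : ℝ[X]) * ((n : ℝ[X]) + 1)) * legendre n := by
  have h := iterate_derivative_recurrence n n
  simp only [Function.iterate_succ_apply'] at h
  rw [legendre_eq_C_mul]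
  simp only [derivative_mul, derivative_C, zero_mul, zero_add, derivative_sub,
    derivative_one, derivative_X_sq, show (C 2 : ℝ[X]) = 2 from map_ofNat C 2]
  linear_combination -C (1 / (2 ^ n * (n.factorial : ℝ))) * h

theorem polyIntegral_one_sub_X_sq_mul_derivative_legendre_mul (n : ℕ) (q : ℝ[X]) :
    polyIntegral ((1 - X ^ 2) * derivative (legendre n) * q)
      = -polyIntegral (legendre n * derivative ((1 - X ^ 2) * q)) := by
  have h := polyIntegral_derivative (legendre n * ((1 - X ^ 2) * q))
  rw [derivative_mul, map_add] at h
  simp only [eval_mul, eval_sub, eval_one, eval_pow, eval_X] at h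
  rw [show (1 - X ^ 2) * derivative (legendre n) * q
    = derivative (legendre n) * ((1 - X ^ 2) * q) by ring]
  linarith

theorem polyIntegral_one_sub_X_sq_mul_derivative_legendre_mul_eq_zero {n : ℕ} {q : ℝ[X]}
    (hq : q.natDegree + 2 ≤ n) :
    polyIntegral ((1 - X ^ 2) * derivative (legendre n) * q) = 0 := by
  have hX : (1 - X ^ 2 : ℝ[X]).natDegree ≤ 2 := by compute_degree
  have h₁ := natDegree_mul_le_of_le hX (le_refl q.natDegree)
  have h₂ := natDegree_derivative_le ((1 - X ^ 2) * q)
  rw [polyIntegral_one_sub_X_sq_mul_derivative_legendre_mul, polyIntegral_legendre_mul, neg_zero]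
  exact degree_le_natDegree.trans_lt (Nat.cast_lt.2 (by omega))

theorem natDegree_add_one_le_of_X_sub_C_mul {t : ℝ} {f : ℝ[X]} {m : ℕ} (hm : 1 ≤ m)
    (h : ((X - C t) * f).natDegree ≤ m) : f.natDegree + 1 ≤ m := by
  by_cases hf : f = 0
  · simpa [hf] using hm
  · rw [natDegree_mul (X_sub_C_ne_zero t) hf, natDegree_X_sub_C] at h
    omega

/-- The integral of the node polynomial `(1 - X²) L'ₙ` with the factor `X - t` removed. -/
theorem eval_legendre_mul_polyIntegral {n : ℕ} (hn : 1 ≤ n) {t : ℝ} {f : ℝ[X]}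
    (hf : (X - C t) * f = (1 - X ^ 2) * derivative (legendre n)) :
    (legendre n).eval t * polyIntegral f = -2 := by
  set L := legendre n with hL
  have hLdeg : L.natDegree ≤ n := natDegree_legendre_le n
  have hL'deg : (derivative L).natDegree ≤ n - 1 :=
    (natDegree_derivative_le L).trans (by omega)
  obtain ⟨g, hg⟩ : X - C t ∣ L - C (L.eval t) := dvd_iff_isRoot.2 (by simp)
  have hg' : derivative L = g + (X - C t) * derivative g := by
    simpa [derivative_mul] using congrArg derivative hg
  have hgdeg : g.natDegree + 1 ≤ n := by
    refine natDegree_add_one_le_of_X_sub_C_mul (t := t) hn ?_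
    rw [← hg, natDegree_sub_C]
    exact hLdeg
  have hlin : ∀ a b : ℝ, (C a * X + C b : ℝ[X]).natDegree ≤ 1 := fun a b => by compute_degree
  have hdeg : ∀ (a b : ℝ) {q : ℝ[X]}, q.natDegree + 1 ≤ n → ((C a * X + C b) * q).natDegree ≤ n :=
    fun a b q hq => natDegree_mul_le.trans (by have := hlin a b; omega)
  have hrem : (X - C t) * (f + derivative ((1 - X ^ 2) * g) + (L + 2 * X * derivative L))
      = (C (-2 * t) * X + C 2) * derivative L + (C (L.eval t) * X + C 0)
        + (C t * X + C (-1)) * g - C t * L := by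
    simp [derivative_mul, show (C 2 : ℝ[X]) = 2 from map_ofNat C 2]
    linear_combination hf - (1 - X ^ 2) * hg' + X * hg
  have hremdeg : (f + derivative ((1 - X ^ 2) * g) + (L + 2 * X * derivative L)).degree
      < (n : WithBot ℕ) := by
    refine degree_le_natDegree.trans_lt (Nat.cast_lt.2
      (natDegree_add_one_le_of_X_sub_C_mul (t := t) hn ?_))
    rw [hrem]
    exact natDegree_sub_le_of_le (natDegree_add_le_of_le (natDegree_add_le_of_le
      (hdeg _ _ (by omega)) ((hlin _ _).trans hn)) (hdeg _ _ hgdeg))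
      ((natDegree_C_mul_le _ _).trans hLdeg) |>.trans (by simp)
  have horth := polyIntegral_legendre_mul hremdeg
  have hXL := polyIntegral_derivative (X * L ^ 2)
  have hends : L.eval 1 ^ 2 = 1 ∧ L.eval (-1) ^ 2 = 1 := by
    rw [hL, eval_one_legendre, eval_neg_one_legendre, ← pow_mul, mul_comm, pow_mul]
    norm_num
  have hXL' : derivative (X * L ^ 2) = L * (L + 2 * X * derivative L) := by
    simp [derivative_mul, derivative_pow, show (C 2 : ℝ[X]) = 2 from map_ofNat C 2]
    ring
  rw [hXL'] at hXL
  simp only [eval_mul, eval_X, eval_pow, hends.1, hends.2] at hXL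
  have hparts := polyIntegral_one_sub_X_sq_mul_derivative_legendre_mul n g
  have hsplit : C (L.eval t) * f = L * f - (1 - X ^ 2) * derivative L * g := by
    linear_combination -g * hf - f * hg
  rw [mul_add, mul_add (legendre n) f, map_add, map_add] at horth
  rw [← polyIntegral_C_mul, hsplit, map_sub]
  linarith

theorem polyIntegral_eq_zero_of_eval_eq_zero {n : ℕ} {τ : Fin (n + 1) → ℝ}
    (hτ : Function.Injective τ) (hM0 : (1 - X ^ 2) * derivative (legendre n) ≠ 0)
    (hM : ∀ i, ((1 - X ^ 2) * derivative (legendre n)).eval (τ i) = 0) {p : ℝ[X]}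
    (hp : p.natDegree ≤ 2 * n - 1) (hroot : ∀ i, p.eval (τ i) = 0) : polyIntegral p = 0 := by
  set ν : ℝ[X] := ∏ i, (X - C (τ i)) with hν
  have hdvd : ∀ q : ℝ[X], (∀ i, q.eval (τ i) = 0) → ν ∣ q := fun q hq =>
    Finset.prod_dvd_of_coprime (fun i _ j _ hij => pairwise_coprime_X_sub_C hτ hij)
      fun i _ => dvd_iff_isRoot.2 (hq i)
  have hν0 : ν ≠ 0 := (monic_prod_X_sub_C τ Finset.univ).ne_zero
  have hνdeg : ν.natDegree = n + 1 := by
    rw [hν, natDegree_prod_of_monic _ _ fun i _ => monic_X_sub_C (τ i)]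
    simp
  obtain ⟨c, hc⟩ := hdvd _ hM
  obtain ⟨q, rfl⟩ := hdvd p hroot
  rcases eq_or_ne q 0 with rfl | hq
  · simp
  rw [natDegree_mul hν0 hq] at hp
  have hc0 : c ≠ 0 := by rintro rfl; exact hM0 (by simpa using hc)
  have hcdeg : c.natDegree = 0 := by
    have hX : (1 - X ^ 2 : ℝ[X]).natDegree ≤ 2 := by compute_degree
    have hL := (natDegree_derivative_le (legendre n)).trans
      (Nat.sub_le_sub_right (natDegree_legendre_le n) 1)
    have h := natDegree_mul_le_of_le hX hL
    rw [hc, natDegree_mul hν0 hc0] at h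
    omega
  obtain ⟨a, rfl⟩ := natDegree_eq_zero.1 hcdeg
  have ha : a ≠ 0 := by rintro rfl; exact hc0 C_0
  have h := polyIntegral_one_sub_X_sq_mul_derivative_legendre_mul_eq_zero
    (n := n) (q := q) (by omega)
  rw [hc, show ν * C a * q = C a * (ν * q) by ring, polyIntegral_C_mul] at h
  exact (mul_eq_zero.1 h).resolve_left ha

/-- Lobatto quadrature at the `n + 1` distinct roots of `(1 - X²) L'ₙ`. -/
theorem polyIntegral_eq_sum {n : ℕ} (hn : 1 ≤ n) {τ : Fin (n + 1) → ℝ}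
    (hτ : Function.Injective τ)
    (hM : ∀ i, ((1 - X ^ 2) * derivative (legendre n)).eval (τ i) = 0) {p : ℝ[X]}
    (hp : p.natDegree ≤ 2 * n - 1) :
    polyIntegral p
      = ∑ i, 2 / (((n : ℝ) + 1) * n * (legendre n).eval (τ i) ^ 2) * p.eval (τ i) := by
  set L := legendre n
  choose f hf using fun i => dvd_iff_isRoot.2 (hM i)
  have hweight : ∀ i, L.eval (τ i) * polyIntegral (f i) = -2 := fun i =>
    eval_legendre_mul_polyIntegral hn (hf i).symm
  have hL0 : ∀ i, L.eval (τ i) ≠ 0 := fun i h => by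
    have := hweight i
    rw [h] at this
    norm_num at this
  have hM0 : (1 - X ^ 2) * derivative L ≠ 0 := fun h => by
    have := eval_legendre_mul_polyIntegral hn (t := 0) (f := 0) (by rw [mul_zero, h])
    norm_num at this
  have hself : ∀ i, (f i).eval (τ i) = -((n : ℝ) * (n + 1)) * L.eval (τ i) := fun i => by
    have h := congrArg (eval (τ i)) (derivative_one_sub_X_sq_mul_derivative_legendre n)
    rw [hf i] at h
    simpa [derivative_mul] using h
  have hother : ∀ i j, i ≠ j → (f i).eval (τ j) = 0 := fun i j hij => by
    have h := hM j
    rw [hf i, eval_mul, eval_sub, eval_X, eval_C] at h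
    exact (mul_eq_zero.1 h).resolve_left (sub_ne_zero.2 fun e => hij (hτ e).symm)
  have hfdeg : ∀ i, (f i).natDegree ≤ 2 * n - 1 := fun i => by
    have hX : (1 - X ^ 2 : ℝ[X]).natDegree ≤ 2 := by compute_degree
    have hL := (natDegree_derivative_le L).trans
      (Nat.sub_le_sub_right (natDegree_legendre_le n) 1)
    have h := natDegree_mul_le_of_le hX hL
    rw [hf i] at h
    have := natDegree_add_one_le_of_X_sub_C_mul (by omega) h
    omega
  have hn0 : (n : ℝ) ≠ 0 := by exact_mod_cast (by omega : n ≠ 0)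
  have hn1 : (n : ℝ) + 1 ≠ 0 := by positivity
  have hzero : polyIntegral
      (p - ∑ i, C (p.eval (τ i) / (-((n : ℝ) * (n + 1)) * L.eval (τ i))) * f i) = 0 := by
    refine polyIntegral_eq_zero_of_eval_eq_zero hτ hM0 hM ?_ fun j => ?_
    · exact natDegree_sub_le_of_le hp (natDegree_sum_le_of_forall_le _ _ fun i _ =>
        (natDegree_C_mul_le _ _).trans (hfdeg i)) |>.trans (by simp)
    · rw [eval_sub, eval_finsetSum, Finset.sum_eq_single j]
      · rw [eval_mul, eval_C, hself, div_mul_cancel₀, sub_self]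
        exact mul_ne_zero (neg_ne_zero.2 (mul_ne_zero hn0 hn1)) (hL0 j)
      · intro i _ hij
        rw [eval_mul, hother i j hij, mul_zero]
      · simp
  rw [map_sub, map_sum, sub_eq_zero] at hzero
  rw [hzero]
  refine Finset.sum_congr rfl fun i _ => ?_
  have := hL0 i
  rw [polyIntegral_C_mul, (eq_div_iff (hL0 i)).2 ((mul_comm _ _).trans (hweight i))]
  field_simp

end LegendreLobatto

/-- Legendre–Gauss–Lobatto quadrature weights: with the LGL nodes
`τ_1 = −1`, `τ_N = 1`, and `τ_2 < ⋯ < τ_{N−1}` the roots of `L′_{N−1}` in `(−1,1)`,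
the weights `w_i = 2 / (N(N−1) L_{N−1}(τ_i)²)` satisfy `w_1 = w_N = 2/(N(N−1))` and
give an exact quadrature for every polynomial of degree at most `2N − 3`. -/
theorem lobatto_quadrature_weights (N : ℕ) (hN : 2 ≤ N) (τ : Fin N → ℝ)
    (hmono : StrictMono τ)
    (h0 : τ ⟨0, by omega⟩ = -1) (hlast : τ ⟨N - 1, by omega⟩ = 1)
    (hroot : ∀ i : Fin N, 0 < (i : ℕ) → (i : ℕ) < N - 1 →
      τ i ∈ Set.Ioo (-1 : ℝ) 1 ∧
        (Polynomial.derivative (legendre (N - 1))).eval (τ i) = 0)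
    (hall : ∀ x ∈ Set.Ioo (-1 : ℝ) 1,
      (Polynomial.derivative (legendre (N - 1))).eval x = 0 → ∃ i, τ i = x)
    (w : Fin N → ℝ)
    (hw : ∀ i, w i = 2 / ((N : ℝ) * ((N : ℝ) - 1) * ((legendre (N - 1)).eval (τ i)) ^ 2)) :
    w ⟨0, by omega⟩ = 2 / ((N : ℝ) * ((N : ℝ) - 1)) ∧
    w ⟨N - 1, by omega⟩ = 2 / ((N : ℝ) * ((N : ℝ) - 1)) ∧
    ∀ p : Polynomial ℝ, p.degree ≤ ((2 * N - 3 : ℕ) : WithBot ℕ) →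
      ∫ x in (-1 : ℝ)..1, p.eval x = ∑ i, w i * p.eval (τ i) := by
  obtain ⟨n, rfl⟩ : ∃ n, N = n + 1 := ⟨N - 1, by omega⟩
  simp only [Nat.add_sub_cancel] at *
  push_cast at *
  simp only [add_sub_cancel_right] at *
  refine ⟨?_, ?_, fun p hp => ?_⟩
  · rw [hw, h0, LegendreLobatto.eval_neg_one_legendre, ← pow_mul, mul_comm n 2, pow_mul]
    norm_num
  · rw [hw, hlast, LegendreLobatto.eval_one_legendre]
    norm_num
  · have hM : ∀ i, ((1 - Polynomial.X ^ 2) * Polynomial.derivative (legendre n)).eval (τ i)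
        = 0 := by
      intro i
      rw [Polynomial.eval_mul]
      rcases Nat.eq_zero_or_pos (i : ℕ) with hi | hi
      · rw [show i = ⟨0, by omega⟩ from Fin.ext hi, h0]
        simp
      rcases lt_or_ge (i : ℕ) n with hi' | hi'
      · rw [(hroot i hi hi').2, mul_zero]
      · rw [show i = ⟨n, by omega⟩ from Fin.ext (by have := i.2; simp; omega), hlast]
        simp
    have hp' : p.natDegree ≤ 2 * n - 1 :=
      (Polynomial.natDegree_le_of_degree_le hp).trans (by omega)
    simp only [hw]
    exact LegendreLobatto.polyIntegral_eq_sum (by omega) hmono.injective hM hp'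
end
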